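/- arXiv:math/0401067 — 3 statements merged into one kernel-verified Lean document; each statement's English description precedes it below -/
import Mathlib

section
/- The number of lattice walks of length 3n that start and end at (0,0), use steps North-East (1,1), West (-1,0), and South (0,-1), and remain in the quadrant i,j ≥ 0, equals 4^n/((n+1)(2n+1)) · binomial(3n, n). -/
/-- The three Kreweras steps: North-East, West, South. -/
def kStep : Fin 3 → ℤ × ℤ
  | 0 => (1, 1)
  | 1 => (-1, 0)
  | 2 => (0, -1)

/-- Position after the first `k` steps of the walk encoded by `f`. -/
def kPos {m : ℕ} (f : Fin m → Fin 3) (k : ℕ) : ℤ × ℤ :=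
  ∑ i ∈ Finset.univ.filter (fun i : Fin m => (i : ℕ) < k), kStep (f i)

/-- The walk stays in the first quadrant. -/
def KInQuadrant {m : ℕ} (f : Fin m → Fin 3) : Prop :=
  ∀ k ≤ m, 0 ≤ (kPos f k).1 ∧ 0 ≤ (kPos f k).2

/-! ### The transfer operator of Kreweras walks -/

/-- The sum of `g i j` over the points `(i, j)` reachable from a point in one step, as a function
of that point. -/
def kTransfer {A : Type*} [AddCommMonoid A] (g : ℕ → ℕ → A) (i j : ℕ) : A :=
  g (i + 1) (j + 1) + (if i = 0 then 0 else g (i - 1) j) + (if j = 0 then 0 else g i (j - 1))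

/-- The sum of `g i j` over all quadrant walks of length `m`, where `(i, j)` is the endpoint. -/
def kSum {A : Type*} [AddCommMonoid A] : ℕ → (ℕ → ℕ → A) → A
  | 0, g => g 0 0
  | m + 1, g => kSum m (kTransfer g)

section Walks

variable {m : ℕ}

theorem kPos_snoc_of_le (f : Fin m → Fin 3) (s : Fin 3) {k : ℕ} (hk : k ≤ m) :
    kPos (Fin.snoc f s : Fin (m + 1) → Fin 3) k = kPos f k := by
  simp [kPos, Finset.sum_filter, Fin.sum_univ_castSucc, hk]

theorem kPos_snoc_last (f : Fin m → Fin 3) (s : Fin 3) :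
    kPos (Fin.snoc f s : Fin (m + 1) → Fin 3) (m + 1) = kPos f m + kStep s := by
  simp [kPos, Finset.sum_filter, Fin.sum_univ_castSucc]

theorem kInQuadrant_snoc (f : Fin m → Fin 3) (s : Fin 3) :
    KInQuadrant (Fin.snoc f s : Fin (m + 1) → Fin 3) ↔
      KInQuadrant f ∧ 0 ≤ (kPos f m + kStep s).1 ∧ 0 ≤ (kPos f m + kStep s).2 := by
  constructor
  · intro h
    refine ⟨fun k hk => ?_, ?_⟩
    · have := h k (hk.trans (Nat.le_succ m))
      rwa [kPos_snoc_of_le f s hk] at this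
    · have := h (m + 1) le_rfl
      rwa [kPos_snoc_last] at this
  · rintro ⟨h, hl⟩ k hk
    rcases Nat.le_succ_iff.mp hk with hk | rfl
    · rw [kPos_snoc_of_le f s hk]
      exact h k hk
    · rwa [kPos_snoc_last]

open Classical in
theorem sum_walks_eq_kSum {A : Type*} [AddCommMonoid A] (m : ℕ) (g : ℕ → ℕ → A) :
    (∑ f : Fin m → Fin 3,
      if KInQuadrant f then g (kPos f m).1.toNat (kPos f m).2.toNat else 0) = kSum m g := by
  induction m generalizing g with
  | zero => simp [kSum, kPos, KInQuadrant]
  | succ m ih =>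
    rw [kSum, ← ih, ← (Fin.snocEquiv fun _ => Fin 3).sum_comp, Fintype.sum_prod_type_right]
    refine Finset.sum_congr rfl fun f _ => ?_
    simp only [Fin.snocEquiv, Equiv.coe_fn_mk, kInQuadrant_snoc, kPos_snoc_last]
    by_cases hf : KInQuadrant f
    · obtain ⟨ha, hb⟩ := hf m le_rfl
      generalize kPos f m = p at ha hb
      obtain ⟨a, b⟩ := p
      lift a to ℕ using ha
      lift b to ℕ using hb
      rcases a with _ | a <;> rcases b with _ | b <;>
        simp [hf, Fin.sum_univ_three, kStep, kTransfer] <;> norm_cast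
    · simp [hf]

end Walks

section Linear

variable {A : Type*} [CommRing A]

theorem kSum_add (m : ℕ) (g h : ℕ → ℕ → A) :
    kSum m (fun i j => g i j + h i j) = kSum m g + kSum m h := by
  induction m generalizing g h with
  | zero => rfl
  | succ m ih =>
    rw [kSum, kSum, kSum, ← ih]
    congr 1
    funext i j
    simp only [kTransfer]
    split_ifs <;> abel

theorem kSum_mul (m : ℕ) (c : A) (g : ℕ → ℕ → A) :
    kSum m (fun i j => c * g i j) = c * kSum m g := by
  induction m generalizing g with
  | zero => rfl
  | succ m ih =>
    rw [kSum, kSum, ← ih]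
    congr 1
    funext i j
    simp only [kTransfer]
    split_ifs <;> ring

theorem map_kSum {B : Type*} [CommRing B] (φ : A →+* B) (m : ℕ) (g : ℕ → ℕ → A) :
    φ (kSum m g) = kSum m (fun i j => φ (g i j)) := by
  induction m generalizing g with
  | zero => rfl
  | succ m ih =>
    rw [kSum, kSum, ih]
    congr 1
    funext i j
    simp only [kTransfer]
    split_ifs <;> simp

/-- The symmetrized generating polynomial of all walks of length `m`. -/
def kPoly (m : ℕ) (x y : A) : A := kSum m fun i j => x ^ i * y ^ j + y ^ i * x ^ j

/-- The symmetrized generating polynomial of the walks of length `m` ending on an axis. -/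
def kAxis (m : ℕ) (x : A) : A :=
  kSum m fun i j => (if j = 0 then x ^ i else 0) + (if i = 0 then x ^ j else 0)

theorem map_kAxis {B : Type*} [CommRing B] (φ : A →+* B) (m : ℕ) (x : A) :
    φ (kAxis m x) = kAxis m (φ x) := by
  simp only [kAxis, map_kSum]
  congr 1
  funext i j
  split_ifs <;> simp

theorem kPoly_succ (m : ℕ) (x y : A) :
    x * y * kPoly (m + 1) x y =
      (x ^ 2 * y ^ 2 + x + y) * kPoly m x y - x * kAxis m x - y * kAxis m y := by
  rw [eq_sub_iff_add_eq, eq_sub_iff_add_eq]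
  simp only [kPoly, kAxis, kSum, ← kSum_mul, ← kSum_add]
  congr 1
  funext i j
  rcases i with _ | i <;> rcases j with _ | j <;> simp [kTransfer] <;> ring

/-- The kernel method: the functional equation on the curve where the kernel vanishes. -/
theorem sum_kAxis_of_kernel {t x y : A} (h : x * y = t * (x ^ 2 * y ^ 2 + x + y)) (N : ℕ) :
    t * (x * ∑ m ∈ Finset.range N, t ^ m * kAxis m x +
      y * ∑ m ∈ Finset.range N, t ^ m * kAxis m y) = x * y * (2 - t ^ N * kPoly N x y) := by
  induction N with
  | zero => simp [kPoly, kSum]; norm_num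
  | succ N ih =>
    rw [Finset.sum_range_succ, Finset.sum_range_succ]
    linear_combination ih + t ^ (N + 1) * kPoly_succ N x y - t ^ N * kPoly N x y * h

theorem kAxis_zero (m : ℕ) :
    kAxis m (0 : A) = 2 * kSum m fun i j => if i = 0 ∧ j = 0 then 1 else 0 := by
  rw [kAxis, ← kSum_mul]
  congr 1
  funext i j
  rcases i with _ | i <;> rcases j with _ | j <;> simp; norm_num

end Linear

/-! ### Parametrization of the kernel curve -/

open PowerSeries in
theorem PowerSeries.eq_zero_of_forall_X_pow_dvd {R : Type*} [CommRing R] {f : PowerSeries R}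
    (h : ∀ k : ℕ, (X : PowerSeries R) ^ k ∣ f) : f = 0 := by
  ext n
  exact X_pow_dvd_iff.mp (h (n + 1)) n (Nat.lt_succ_self n)

open PowerSeries in
theorem PowerSeries.exists_eq_X_mul_eval {R : Type*} [CommRing R]
    (P : Polynomial (PowerSeries R)) : ∃ r : PowerSeries R, r = X * P.eval r := by
  let y : ℕ → PowerSeries R := fun k => (fun z => X * P.eval z)^[k] 0
  have ys : ∀ k, y (k + 1) = X * P.eval (y k) := fun k => Function.iterate_succ_apply' _ _ _
  have hy : ∀ k, (X : PowerSeries R) ^ k ∣ y (k + 1) - y k := by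
    intro k
    induction k with
    | zero => simp
    | succ k ih =>
      rw [ys (k + 1)]
      nth_rewrite 2 [ys k]
      rw [← mul_sub, pow_succ']
      exact mul_dvd_mul_left _ (ih.trans (Polynomial.sub_dvd_eval_sub (y (k + 1)) (y k) P))
  have hy' : ∀ k l, (X : PowerSeries R) ^ k ∣ y (k + l) - y k := by
    intro k l
    induction l with
    | zero => simp
    | succ l ih =>
      have := (pow_dvd_pow X (Nat.le_add_right k l)).trans (hy (k + l))
      simpa [add_assoc] using dvd_add this ih
  let r : PowerSeries R := PowerSeries.mk fun n => coeff n (y (n + 1))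
  have hr : ∀ k, (X : PowerSeries R) ^ k ∣ y k - r := by
    intro k
    rw [X_pow_dvd_iff]
    intro n hn
    obtain ⟨l, rfl⟩ := Nat.exists_eq_add_of_le hn
    have := X_pow_dvd_iff.mp (hy' (n + 1) l) n (Nat.lt_succ_self n)
    simpa [r] using this
  refine ⟨r, sub_eq_zero.mp (eq_zero_of_forall_X_pow_dvd fun k => ?_)⟩
  have h₁ : (X : PowerSeries R) ^ k ∣ y (k + 1) - r :=
    (pow_dvd_pow X (Nat.le_succ k)).trans (hr (k + 1))
  have h₂ : (X : PowerSeries R) ^ k ∣ X * P.eval (y k) - X * P.eval r := by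
    rw [← mul_sub]
    exact ((hr k).trans (Polynomial.sub_dvd_eval_sub _ _ _)).mul_left _
  have := dvd_sub h₂ h₁
  rw [ys k] at this
  simpa using this

section Kernel

open PowerSeries

theorem constantCoeff_two : constantCoeff (2 : ℚ⟦X⟧) = 2 := map_ofNat constantCoeff 2

/-- For every nonzero constant `v`, the curve parametrizing the kernel has a branch `r`
vanishing at the origin. -/
theorem exists_kernel_branch {K : Type*} [Field K] [CharZero K] {v : K} (hv : v ≠ 0) :
    ∃ r : K⟦X⟧, constantCoeff r = 0 ∧
      C v * (2 - C v * X ^ 2) * (r * (2 - r * X ^ 2)) = X * (C v + r - C v * r * X ^ 2) := by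
  let Y : Polynomial K⟦X⟧ := Polynomial.X
  let c : K⟦X⟧ := C v
  obtain ⟨r, hr⟩ := PowerSeries.exists_eq_X_mul_eval
    (Polynomial.C (C (4 * v)⁻¹) * (Polynomial.C c + Y - Polynomial.C (c * X ^ 2) * Y +
      Polynomial.C (c * X) * Y * (2 * Y + Polynomial.C (2 * c) - Polynomial.C (c * X ^ 2) * Y)))
  refine ⟨r, by rw [hr]; simp, ?_⟩
  simp only [Polynomial.eval_mul, Polynomial.eval_add, Polynomial.eval_sub, Polynomial.eval_C,
    Polynomial.eval_X, Polynomial.eval_ofNat, Y] at hr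
  have hc : 4 * c * C (4 * v)⁻¹ = 1 := by
    have : (4 : K⟦X⟧) = C (4 : K) := (map_ofNat C 4).symm
    rw [this, ← map_mul, ← map_mul, mul_inv_cancel₀ (by simpa using hv), map_one]
  change c * (2 - c * X ^ 2) * (r * (2 - r * X ^ 2)) = X * (c + r - c * r * X ^ 2)
  linear_combination 4 * c * hr + X * (c + r - c * X ^ 2 * r + c * X * r *
    (2 * r + 2 * c - c * X ^ 2 * r)) * hc

/-- The length variable `t` in terms of the uniformizer `X`: `t = X / (2 + X ^ 3)`. -/
noncomputable def kTime : ℚ⟦X⟧ := X * (2 + X ^ 3)⁻¹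

theorem kTime_mul : kTime * (2 + X ^ 3) = X := by
  rw [kTime, mul_assoc, PowerSeries.inv_mul_cancel _ (by simp [constantCoeff_two]), mul_one]

theorem X_dvd_kTime : X ∣ kTime := Dvd.intro _ rfl

theorem two_add_X_pow_ne_zero : (2 + X ^ 3 : ℚ⟦X⟧) ≠ 0 := by
  intro h
  simpa [constantCoeff_two] using congrArg constantCoeff h

theorem kernel_of_param {x y v r : ℚ⟦X⟧} (hx : x = v * (2 - v * X ^ 2))
    (hy : y = r * (2 - r * X ^ 2)) (h : x * y = X * (v + r - v * r * X ^ 2)) :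
    x * y = kTime * (x ^ 2 * y ^ 2 + x + y) := by
  apply mul_right_cancel₀ two_add_X_pow_ne_zero
  have h' : (2 + X ^ 3) * (x * y) = X * (x ^ 2 * y ^ 2 + x + y) := by
    subst hx hy
    linear_combination (2 - X * (v * (2 - v * X ^ 2) * (r * (2 - r * X ^ 2)))
      - X ^ 2 * (v + r - v * r * X ^ 2)) * h
  linear_combination h' - (x ^ 2 * y ^ 2 + x + y) * kTime_mul

/-- The polynomial in `v` measuring the defect of the first `N` terms of the generating function
of walks ending on an axis from its closed form, divided by `v`. -/
noncomputable def kDefect (N : ℕ) : Polynomial ℚ⟦X⟧ :=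
  let V : Polynomial ℚ⟦X⟧ := Polynomial.X
  let w : Polynomial ℚ⟦X⟧ := Polynomial.C X
  Polynomial.C kTime * (2 - V * w ^ 2) ^ 2 *
      ∑ m ∈ Finset.range N, Polynomial.C kTime ^ m * kAxis m (V * (2 - V * w ^ 2)) -
    (2 * w * (2 - V * w ^ 2) - w ^ 4)

theorem eval_kDefect (N : ℕ) (v : ℚ⟦X⟧) :
    (kDefect N).eval v = kTime * (2 - v * X ^ 2) ^ 2 *
      ∑ m ∈ Finset.range N, kTime ^ m * kAxis m (v * (2 - v * X ^ 2)) -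
        (2 * X * (2 - v * X ^ 2) - X ^ 4) := by
  have h : ∀ m, Polynomial.eval v
      (kAxis m (Polynomial.X * (2 - Polynomial.X * Polynomial.C X ^ 2))) =
        kAxis m (v * (2 - v * X ^ 2)) := by
    intro m
    rw [← Polynomial.coe_evalRingHom, map_kAxis]
    simp
  simp [kDefect, Polynomial.eval_finsetSum, h]

theorem kDefect_relation (N : ℕ) {v r : ℚ⟦X⟧}
    (h : v * (2 - v * X ^ 2) * (r * (2 - r * X ^ 2)) = X * (v + r - v * r * X ^ 2)) :
    X ^ N ∣ (2 - r * X ^ 2) * (v * (kDefect N).eval v) +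
      (2 - v * X ^ 2) * (r * (kDefect N).eval r) := by
  have hk := sum_kAxis_of_kernel (kernel_of_param rfl rfl h) N
  rw [eval_kDefect, eval_kDefect]
  set x := v * (2 - v * X ^ 2) with hx
  set y := r * (2 - r * X ^ 2) with hy
  have : (2 - r * X ^ 2) * (v * (kTime * (2 - v * X ^ 2) ^ 2 *
      ∑ m ∈ Finset.range N, kTime ^ m * kAxis m x - (2 * X * (2 - v * X ^ 2) - X ^ 4))) +
      (2 - v * X ^ 2) * (r * (kTime * (2 - r * X ^ 2) ^ 2 *
      ∑ m ∈ Finset.range N, kTime ^ m * kAxis m y - (2 * X * (2 - r * X ^ 2) - X ^ 4))) =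
      kTime ^ N * (-((2 - v * X ^ 2) * (2 - r * X ^ 2) * (x * y * kPoly N x y))) := by
    linear_combination (2 - v * X ^ 2) * (2 - r * X ^ 2) * hk
      + (2 * (2 - v * X ^ 2) * (2 - r * X ^ 2) - 2 * X ^ 3) * h
      - (2 - v * X ^ 2) * (2 - r * X ^ 2) * kTime *
        (∑ m ∈ Finset.range N, kTime ^ m * kAxis m x) * hx
      - (2 - v * X ^ 2) * (2 - r * X ^ 2) * kTime *
        (∑ m ∈ Finset.range N, kTime ^ m * kAxis m y) * hy
      + 2 * X ^ 3 * (y * hx + v * (2 - v * X ^ 2) * hy)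
  rw [this]
  exact (pow_dvd_pow_of_dvd X_dvd_kTime N).mul_right _

theorem C_X_pow_dvd_kDefect (N : ℕ) : Polynomial.C (X ^ N) ∣ kDefect N := by
  suffices H : ∀ k ≤ N, Polynomial.C (X ^ k) ∣ kDefect N from H N le_rfl
  intro k
  induction k with
  | zero => simp
  | succ k ih =>
    intro hk
    obtain ⟨G, hG⟩ := ih (Nat.le_of_succ_le hk)
    have hg : G.map (constantCoeff (R := ℚ)) = 0 := by
      have hroot : ∀ v : ℚ, v ≠ 0 → (G.map constantCoeff).eval v = 0 := by
        intro v hv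
        obtain ⟨r, hr, h⟩ := exists_kernel_branch hv
        have hd := (pow_dvd_pow X hk).trans (kDefect_relation N h)
        have e : (2 - r * X ^ 2) * (C v * (kDefect N).eval (C v)) +
            (2 - C v * X ^ 2) * (r * (kDefect N).eval r) =
            X ^ k * ((2 - r * X ^ 2) * (C v * G.eval (C v)) +
              (2 - C v * X ^ 2) * (r * G.eval r)) := by
          rw [hG]
          simp only [Polynomial.eval_mul, Polynomial.eval_C]
          ring
        rw [e, pow_succ, mul_dvd_mul_iff_left (pow_ne_zero _ X_ne_zero), X_dvd_iff] at hd
        have hev : constantCoeff (G.eval (C v)) = (G.map constantCoeff).eval v := by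
          rw [← Polynomial.eval_map_apply]
          simp
        simpa [hr, hev, hv, constantCoeff_two] using hd
      exact Polynomial.eq_zero_of_infinite_isRoot _
        ((Set.finite_singleton (0 : ℚ)).infinite_compl.mono hroot)
    have hX : Polynomial.C X ∣ G := by
      rw [Polynomial.C_dvd_iff_dvd_coeff]
      intro i
      rw [X_dvd_iff, ← Polynomial.coeff_map, hg, Polynomial.coeff_zero]
    rw [hG, pow_succ, map_mul]
    exact mul_dvd_mul_left _ hX

/-- The number of walks of length `m` from the origin to itself. -/
def kLoops (m : ℕ) : ℚ := kSum m fun i j => if i = 0 ∧ j = 0 then 1 else 0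

theorem kAxis_zero_eq_C (m : ℕ) : kAxis m (0 : ℚ⟦X⟧) = 2 * C (kLoops m) := by
  rw [kAxis_zero, kLoops, map_kSum]
  congr 2
  funext i j
  split_ifs <;> simp

theorem sum_kLoops (N : ℕ) :
    X ^ N ∣ 8 * ∑ m ∈ Finset.range (N + 1), C (kLoops m) * kTime ^ m -
      (2 + X ^ 3) * (4 - X ^ 3) := by
  have h : X ^ (N + 1) ∣ (kDefect (N + 1)).eval 0 := by
    obtain ⟨G, hG⟩ := C_X_pow_dvd_kDefect (N + 1)
    exact ⟨G.eval 0, by rw [hG]; simp⟩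
  rw [eval_kDefect] at h
  simp only [zero_mul, sub_zero, kAxis_zero_eq_C] at h
  replace h := h.mul_left (2 + X ^ 3)
  rw [pow_succ'] at h
  refine (mul_dvd_mul_iff_left X_ne_zero).mp (h.trans (dvd_of_eq ?_))
  have e : ∑ m ∈ Finset.range (N + 1), kTime ^ m * (2 * C (kLoops m)) =
      2 * ∑ m ∈ Finset.range (N + 1), C (kLoops m) * kTime ^ m := by
    rw [Finset.mul_sum]
    exact Finset.sum_congr rfl fun _ _ => by ring
  rw [e]
  linear_combination (8 * ∑ m ∈ Finset.range (N + 1), C (kLoops m) * kTime ^ m) * kTime_mul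

theorem coeff_eq_zero_of_X_pow_dvd_sum {c : ℕ → ℚ} {N M : ℕ} (hM : M ≤ N)
    (h : X ^ M ∣ ∑ m ∈ Finset.range N, C (c m) * kTime ^ m) : ∀ m < M, c m = 0 := by
  intro m
  induction m using Nat.strong_induction_on with
  | _ m ih =>
    intro hm
    have hc := X_pow_dvd_iff.mp h m hm
    rw [map_sum, Finset.sum_eq_single m] at hc
    · rw [coeff_C_mul, kTime, mul_pow, coeff_X_pow_mul', if_pos le_rfl, Nat.sub_self,
        coeff_zero_eq_constantCoeff_apply, map_pow, constantCoeff_inv] at hc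
      simpa [constantCoeff_two] using hc
    · intro j _ hj
      rcases lt_or_gt_of_ne hj with hj | hj
      · rw [ih j hj (hj.trans hm)]
        simp
      · rw [coeff_C_mul, kTime, mul_pow, coeff_X_pow_mul', if_neg (by omega), mul_zero]
    · intro hj
      exact absurd (Finset.mem_range.mpr (hm.trans_le hM)) hj

/-- The Euler operator `t d/dt` on power series in the uniformizer `X`. -/
noncomputable def kEuler : Derivation ℚ ℚ⟦X⟧ ℚ⟦X⟧ :=
  ((2 + X ^ 3) * (2 - 2 * X ^ 3)⁻¹ * X : ℚ⟦X⟧) • derivative ℚ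

theorem mul_kEuler (f : ℚ⟦X⟧) :
    (2 - 2 * X ^ 3) * kEuler f = (2 + X ^ 3) * X * derivative ℚ f := by
  have : (2 - 2 * X ^ 3) * (2 - 2 * X ^ 3 : ℚ⟦X⟧)⁻¹ = 1 :=
    PowerSeries.mul_inv_cancel _ (by simp [constantCoeff_two])
  simp only [kEuler, Derivation.smul_apply, smul_eq_mul]
  linear_combination (2 + X ^ 3) * X * derivative ℚ f * this

theorem two_sub_X_pow_ne_zero : (2 - 2 * X ^ 3 : ℚ⟦X⟧) ≠ 0 := by
  intro h
  simpa [constantCoeff_two] using congrArg constantCoeff h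

theorem mul_kEuler_X : (2 - 2 * X ^ 3) * kEuler X = (2 + X ^ 3) * X := by
  rw [mul_kEuler, derivative_X, mul_one]

theorem kEuler_X_pow (n : ℕ) : kEuler (X ^ n) = (n : ℚ⟦X⟧) * X ^ (n - 1) * kEuler X := by
  rw [Derivation.leibniz_pow, nsmul_eq_mul, smul_eq_mul, mul_assoc]

theorem kEuler_two : kEuler 2 = 0 := by
  simpa using kEuler.map_natCast 2

theorem kEuler_kTime : kEuler kTime = kTime := by
  have h := congrArg kEuler kTime_mul
  rw [Derivation.leibniz, map_add, kEuler_X_pow, kEuler_two] at h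
  simp only [smul_eq_mul, zero_add, Nat.cast_ofNat, Nat.add_one_sub_one] at h
  apply mul_left_cancel₀ two_sub_X_pow_ne_zero
  apply mul_left_cancel₀ two_add_X_pow_ne_zero
  linear_combination (2 - 2 * X ^ 3) * h + (1 - 3 * X ^ 2 * kTime) * mul_kEuler_X
    - (2 + X ^ 3) * kTime_mul

theorem kEuler_kTime_pow (a : ℚ) (m : ℕ) :
    kEuler (C a * kTime ^ m) = C (m * a) * kTime ^ m := by
  rw [← smul_eq_C_mul, Derivation.map_smul, Derivation.leibniz_pow, kEuler_kTime,
    smul_eq_C_mul, map_mul]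
  rcases m with _ | m
  · simp
  · simp [pow_succ]
    ring

theorem X_pow_dvd_kEuler {f : ℚ⟦X⟧} {M : ℕ} (h : X ^ M ∣ f) : X ^ M ∣ kEuler f := by
  obtain ⟨g, rfl⟩ := h
  have hX : X ∣ kEuler X := by
    simp only [kEuler, Derivation.smul_apply, derivative_X, smul_eq_mul, mul_one]
    exact Dvd.intro_left _ rfl
  rw [Derivation.leibniz, kEuler_X_pow]
  refine dvd_add (Dvd.intro _ rfl) ?_
  rcases M with _ | M
  · simp
  · rw [pow_succ, Nat.add_sub_cancel, smul_eq_mul]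
    exact ((mul_dvd_mul (Dvd.intro_left _ rfl) hX).mul_left _)

theorem kEuler_closedForm :
    kEuler ((2 + X ^ 3) * (4 - X ^ 3)) = 3 * X ^ 3 * (2 + X ^ 3) := by
  have h4 : kEuler 4 = 0 := by simpa using kEuler.map_natCast 4
  rw [Derivation.leibniz, map_add, map_sub, kEuler_X_pow, kEuler_two, h4]
  simp only [smul_eq_mul, Nat.cast_ofNat, Nat.add_one_sub_one]
  linear_combination 3 * X ^ 2 * mul_kEuler_X

theorem kEuler_kEuler_closedForm :
    kEuler (3 * X ^ 3 * (2 + X ^ 3)) = 18 * X ^ 2 * (1 + X ^ 3) * kEuler X := by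
  have h3 : kEuler 3 = 0 := by simpa using kEuler.map_natCast 3
  rw [Derivation.leibniz, Derivation.leibniz, map_add, kEuler_X_pow, kEuler_two, h3]
  simp only [smul_eq_mul, Nat.cast_ofNat, Nat.add_one_sub_one]
  ring

/-- The hypergeometric differential operator annihilating the generating function of loops, up to
a constant. -/
noncomputable def kOperator (f : ℚ⟦X⟧) : ℚ⟦X⟧ :=
  2 * kEuler (kEuler f) + 9 * kEuler f + 9 * f -
    54 * kTime ^ 3 * (kEuler (kEuler f) + 3 * kEuler f + 2 * f)

theorem kOperator_sub (f g : ℚ⟦X⟧) : kOperator (f - g) = kOperator f - kOperator g := by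
  simp only [kOperator, map_sub]
  ring

theorem X_pow_dvd_kOperator {f : ℚ⟦X⟧} {M : ℕ} (h : X ^ M ∣ f) : X ^ M ∣ kOperator f := by
  have h₁ := X_pow_dvd_kEuler h
  have h₂ := X_pow_dvd_kEuler h₁
  exact dvd_sub (dvd_add (dvd_add (h₂.mul_left _) (h₁.mul_left _)) (h.mul_left _))
    ((dvd_add (dvd_add h₂ (h₁.mul_left _)) (h.mul_left _)).mul_left _)

theorem kOperator_closedForm : kOperator ((2 + X ^ 3) * (4 - X ^ 3)) = 72 := by
  rw [kOperator, kEuler_closedForm, kEuler_kEuler_closedForm]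
  have ht : kTime ^ 3 * (2 + X ^ 3) ^ 3 = X ^ 3 := by rw [← mul_pow, kTime_mul]
  apply mul_left_cancel₀ two_sub_X_pow_ne_zero
  linear_combination (36 * X ^ 2 * (1 + X ^ 3) - 54 * kTime ^ 3 * (18 * X ^ 2 * (1 + X ^ 3))) *
    mul_kEuler_X - 216 * ht

theorem kOperator_sum (N : ℕ) (q : ℕ → ℚ) :
    kOperator (8 * ∑ m ∈ Finset.range N, C (q m) * kTime ^ m) =
      8 * (∑ m ∈ Finset.range N, C ((m + 3) * (2 * m + 3) * q m) * kTime ^ m -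
        ∑ m ∈ Finset.range N, C (54 * ((m + 2) * (m + 1)) * q m) * kTime ^ (m + 3)) := by
  have h8 : ∀ f : ℚ⟦X⟧, kEuler (8 * f) = 8 * kEuler f := by
    intro f
    have h : kEuler 8 = 0 := by simpa using kEuler.map_natCast 8
    rw [Derivation.leibniz, h]
    simp
  simp only [kOperator, h8, map_sum, kEuler_kTime_pow, Finset.mul_sum, ← Finset.sum_add_distrib,
    ← Finset.sum_sub_distrib]
  refine Finset.sum_congr rfl fun m _ => ?_
  simp only [map_mul, map_add, map_natCast, map_ofNat, map_one]
  ring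

theorem kLoops_recurrence (m : ℕ) :
    (m + 6) * (2 * m + 9) * kLoops (m + 3) = 54 * ((m + 2) * (m + 1)) * kLoops m := by
  have h := X_pow_dvd_kOperator (sum_kLoops (m + 4))
  rw [kOperator_sub, kOperator_closedForm, kOperator_sum] at h
  set N := m + 4 + 1 with hN
  let c : ℕ → ℚ := fun k => (if k < N then (k + 3) * (2 * k + 3) * kLoops k else 0) -
    (if k < 3 then 0 else 54 * (((k - 3 : ℕ) + 2) * ((k - 3 : ℕ) + 1)) * kLoops (k - 3)) -
    if k = 0 then 9 else 0
  have e : X ^ (m + 4) ∣ ∑ k ∈ Finset.range (N + 3), C (c k) * kTime ^ k := by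
    have e₁ : ∑ k ∈ Finset.range (N + 3),
        C (if k < N then ((k : ℚ) + 3) * (2 * k + 3) * kLoops k else 0) * kTime ^ k =
        ∑ k ∈ Finset.range N, C ((k + 3) * (2 * k + 3) * kLoops k) * kTime ^ k := by
      rw [Finset.sum_range_add]
      simp only [add_lt_iff_neg_left, not_lt_zero, if_false, map_zero, zero_mul,
        Finset.sum_const_zero, add_zero]
      exact Finset.sum_congr rfl fun k hk => by rw [if_pos (Finset.mem_range.mp hk)]
    have e₂ : ∑ k ∈ Finset.range (N + 3), C (if k < 3 then 0 else
        54 * (((k - 3 : ℕ) + 2 : ℚ) * ((k - 3 : ℕ) + 1)) * kLoops (k - 3)) * kTime ^ k =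
        ∑ k ∈ Finset.range N, C (54 * ((k + 2) * (k + 1)) * kLoops k) * kTime ^ (k + 3) := by
      rw [add_comm N 3, Finset.sum_range_add]
      simp [Finset.sum_range_succ _ 2, Finset.sum_range_succ _ 1, add_comm 3]
    have e₃ : ∑ k ∈ Finset.range (N + 3), C (if k = 0 then (9 : ℚ) else 0) * kTime ^ k = 9 := by
      rw [Finset.sum_eq_single 0]
      · simpa using map_ofNat (C (R := ℚ)) 9
      · intro k _ hk
        simp [hk]
      · simp
    have h8 : IsUnit (8 : ℚ⟦X⟧) := by
      rw [isUnit_iff_constantCoeff, map_ofNat]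
      simp
    simp only [c, map_sub, sub_mul, Finset.sum_sub_distrib, e₁, e₂, e₃]
    rw [← h8.dvd_mul_left]
    exact h.trans (dvd_of_eq (by ring))
  have hc := coeff_eq_zero_of_X_pow_dvd_sum (by omega) e (m + 3) (by omega)
  simp [c, hN] at hc
  linarith

end Kernel

theorem choose_three_mul_succ (n : ℕ) :
    ((3 * (n + 1)).choose (n + 1) : ℚ) * (2 * (n + 1) * (2 * n + 1)) =
      3 * (3 * n + 2) * (3 * n + 1) * (3 * n).choose n := by
  have h₁ := Nat.choose_mul_factorial_mul_factorial (show n ≤ 3 * n by omega)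
  have h₂ := Nat.choose_mul_factorial_mul_factorial (show n + 1 ≤ 3 * (n + 1) by omega)
  rw [show 3 * n - n = 2 * n by omega] at h₁
  rw [show 3 * (n + 1) - (n + 1) = 2 * n + 1 + 1 by omega, show 3 * (n + 1) = 3 * n + 2 + 1 by ring]
    at h₂
  simp only [Nat.factorial_succ] at h₂
  rw [show 3 * (n + 1) = 3 * n + 2 + 1 by ring]
  have h₃ : (n.factorial : ℚ) ≠ 0 := by positivity
  have h₄ : ((2 * n).factorial : ℚ) ≠ 0 := by positivity
  have h₅ : (n + 1 : ℚ) ≠ 0 := by positivity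
  have h₁' := congrArg (Nat.cast (R := ℚ)) h₁
  have h₂' := congrArg (Nat.cast (R := ℚ)) h₂
  push_cast at h₁' h₂'
  apply mul_right_cancel₀ (mul_ne_zero (mul_ne_zero h₃ h₄) h₅)
  linear_combination h₂' - (3 * n + 3) * (3 * n + 2) * (3 * n + 1) * h₁'

theorem kLoops_three_mul (n : ℕ) :
    kLoops (3 * n) = 4 ^ n / ((n + 1) * (2 * n + 1)) * (3 * n).choose n := by
  induction n with
  | zero => simp [kLoops, kSum]
  | succ n ih =>
    have h := kLoops_recurrence (3 * n)
    rw [ih] at h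
    have hc := choose_three_mul_succ n
    rw [show 3 * (n + 1) = 3 * n + 3 by ring] at hc ⊢
    have h₁ : (n + 1 : ℚ) ≠ 0 := by positivity
    have h₂ : (2 * n + 1 : ℚ) ≠ 0 := by positivity
    have hb : 54 * (((3 * n : ℕ) + 2 : ℚ) * ((3 * n : ℕ) + 1)) *
        (4 ^ n / ((n + 1) * (2 * n + 1)) * (3 * n).choose n) =
        36 * 4 ^ n * (3 * n + 3).choose (n + 1) := by
      push_cast
      rw [div_mul_eq_mul_div, mul_div_assoc', div_eq_iff (mul_ne_zero h₁ h₂)]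
      linear_combination -18 * 4 ^ n * hc
    rw [hb] at h
    push_cast at h ⊢
    rw [div_mul_eq_mul_div, eq_div_iff (by positivity)]
    linear_combination h / 9

theorem kreweras_count_origin (n : ℕ) :
    (Nat.card {f : Fin (3 * n) → Fin 3 //
        KInQuadrant f ∧ kPos f (3 * n) = (0, 0)} : ℚ) =
      4 ^ n / ((n + 1) * (2 * n + 1)) * Nat.choose (3 * n) n := by
  classical
  rw [← kLoops_three_mul, kLoops, ← sum_walks_eq_kSum, Nat.card_eq_fintype_card,
    Fintype.card_subtype, Finset.card_filter, Nat.cast_sum]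
  refine Finset.sum_congr rfl fun f _ => ?_
  by_cases hf : KInQuadrant f
  · obtain ⟨ha, hb⟩ := hf _ le_rfl
    simp [hf, Prod.ext_iff, Int.toNat_eq_zero, ha.ge_iff_eq', hb.ge_iff_eq']
  · simp [hf]
end

section
/- The number of lattice walks of length 2n in Z² that start and end at (0,0), use unit steps North, South, East, West, and remain in the quadrant i,j ≥ 0, equals 1/((2n+1)(2n+4)) · binomial(2n+2, n+1)². -/
/-- The four unit steps: North, South, East, West. -/
def sStep : Fin 4 → ℤ × ℤ
  | 0 => (0, 1)
  | 1 => (0, -1)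
  | 2 => (1, 0)
  | 3 => (-1, 0)

/-- Position after the first `k` steps of the walk encoded by `f`. -/
def sPos {m : ℕ} (f : Fin m → Fin 4) (k : ℕ) : ℤ × ℤ :=
  ∑ i ∈ Finset.univ.filter (fun i : Fin m => (i : ℕ) < k), sStep (f i)

/-- The walk stays in the first quadrant. -/
def SInQuadrant {m : ℕ} (f : Fin m → Fin 4) : Prop :=
  ∀ k ≤ m, 0 ≤ (sPos f k).1 ∧ 0 ≤ (sPos f k).2

theorem sPos_snoc_of_le {m : ℕ} (f : Fin m → Fin 4) (a : Fin 4) {k : ℕ} (hk : k ≤ m) :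
    sPos (Fin.snoc f a : Fin (m + 1) → Fin 4) k = sPos f k := by
  simp [sPos, Finset.sum_filter, Fin.sum_univ_castSucc, hk]

theorem sPos_self {m : ℕ} (f : Fin m → Fin 4) : sPos f m = ∑ i, sStep (f i) := by
  simp [sPos]

theorem sPos_snoc_last {m : ℕ} (f : Fin m → Fin 4) (a : Fin 4) :
    sPos (Fin.snoc f a : Fin (m + 1) → Fin 4) (m + 1) = sPos f m + sStep a := by
  simp [sPos_self, Fin.sum_univ_castSucc]

theorem sInQuadrant_snoc {m : ℕ} (f : Fin m → Fin 4) (a : Fin 4) :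
    SInQuadrant (Fin.snoc f a : Fin (m + 1) → Fin 4) ↔
      SInQuadrant f ∧ 0 ≤ (sPos f m + sStep a).1 ∧ 0 ≤ (sPos f m + sStep a).2 := by
  constructor
  · intro h
    refine ⟨fun k hk => ?_, ?_⟩
    · rw [← sPos_snoc_of_le f a hk]
      exact h k (by omega)
    · rw [← sPos_snoc_last f a]
      exact h (m + 1) le_rfl
  · rintro ⟨h, h'⟩ k hk
    rcases Nat.le_succ_iff.mp hk with hk | rfl
    · rw [sPos_snoc_of_le f a hk]
      exact h k hk
    · rw [sPos_snoc_last]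
      exact h'

open Classical in
/-- The number of quadrant walks of length `m` ending at `p`. -/
noncomputable def quadrantCount (m : ℕ) (p : ℤ × ℤ) : ℤ :=
  ∑ f : Fin m → Fin 4, if SInQuadrant f ∧ sPos f m = p then 1 else 0

theorem natCard_eq_quadrantCount (m : ℕ) (p : ℤ × ℤ) :
    (Nat.card {f : Fin m → Fin 4 // SInQuadrant f ∧ sPos f m = p} : ℤ) =
      quadrantCount m p := by
  classical
  rw [Nat.card_eq_fintype_card, Fintype.card_subtype, quadrantCount, Finset.sum_boole]

theorem quadrantCount_eq_zero (m : ℕ) {p : ℤ × ℤ} (hp : ¬(0 ≤ p.1 ∧ 0 ≤ p.2)) :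
    quadrantCount m p = 0 := by
  refine Finset.sum_eq_zero fun f _ => if_neg ?_
  rintro ⟨h, rfl⟩
  exact hp (h m le_rfl)

theorem quadrantCount_zero (p : ℤ × ℤ) :
    quadrantCount 0 p = if p = 0 then 1 else 0 := by
  simp [quadrantCount, SInQuadrant, sPos, eq_comm]

theorem quadrantCount_succ (m : ℕ) {p : ℤ × ℤ} (hp : 0 ≤ p.1 ∧ 0 ≤ p.2) :
    quadrantCount (m + 1) p = ∑ a, quadrantCount m (p - sStep a) := by
  classical
  unfold quadrantCount
  rw [← (Fin.snocEquiv fun _ : Fin (m + 1) => Fin 4).sum_comp, Fintype.sum_prod_type]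
  refine Finset.sum_congr rfl fun a _ => Finset.sum_congr rfl fun f _ => ?_
  refine if_congr ?_ rfl rfl
  change SInQuadrant (Fin.snoc f a : Fin (m + 1) → Fin 4) ∧
    sPos (Fin.snoc f a : Fin (m + 1) → Fin 4) (m + 1) = p ↔ _
  rw [sInQuadrant_snoc, sPos_snoc_last, eq_sub_iff_add_eq]
  constructor
  · rintro ⟨⟨h, -⟩, h'⟩
    exact ⟨h, h'⟩
  · rintro ⟨h, rfl⟩
    exact ⟨⟨h, hp⟩, rfl⟩

/-- The number of one-dimensional walks with `m` steps `±1` from `0` to `k`. -/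
def lineCount : ℕ → ℤ → ℤ
  | 0, k => if k = 0 then 1 else 0
  | m + 1, k => lineCount m (k - 1) + lineCount m (k + 1)

theorem lineCount_neg (m : ℕ) (k : ℤ) : lineCount m (-k) = lineCount m k := by
  induction m generalizing k with
  | zero => simp [lineCount]
  | succ m ih =>
    rw [lineCount, lineCount, ← ih (k - 1), ← ih (k + 1), add_comm]
    congr 2 <;> ring

theorem lineCount_eq_zero (m : ℕ) (k : ℤ) (hk : k < -m) : lineCount m k = 0 := by
  induction m generalizing k with
  | zero => rw [lineCount, if_neg (by simp at hk; omega)]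
  | succ m ih =>
    push_cast at hk
    rw [lineCount, ih _ (by omega), ih _ (by omega), add_zero]

theorem lineCount_two_mul_sub (m k : ℕ) : lineCount m (2 * k - m) = m.choose k := by
  induction m generalizing k with
  | zero =>
    cases k with
    | zero => simp [lineCount]
    | succ k =>
      simp [lineCount]
      omega
  | succ m ih =>
    rw [lineCount]
    cases k with
    | zero =>
      rw [lineCount_eq_zero m _ (by push_cast; omega)]
      have h := ih 0
      simp only [Nat.choose_zero_right] at h ⊢
      rw [← h, zero_add]
      congr 1
      push_cast
      ring
    | succ k =>
      rw [Nat.choose_succ_succ', Nat.cast_add (m.choose k), ← ih k, ← ih (k + 1)]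
      congr 2 <;> push_cast <;> ring

/-- The signed count of plane walks produced by the reflection principle, in the coordinates
`u = i + j`, `v = i - j`, in which the two coordinates of a walk are independent. -/
def reflectedCount (m : ℕ) (u v : ℤ) : ℤ :=
  lineCount m u * lineCount m v - lineCount m (u + 2) * lineCount m (v + 2)
    - lineCount m (u + 2) * lineCount m (v - 2) + lineCount m (u + 4) * lineCount m v

theorem reflectedCount_succ (m : ℕ) (u v : ℤ) :
    reflectedCount (m + 1) u v =
      reflectedCount m (u - 1) (v + 1) + reflectedCount m (u + 1) (v - 1) +
        reflectedCount m (u - 1) (v - 1) + reflectedCount m (u + 1) (v + 1) := by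
  simp only [reflectedCount, lineCount]
  ring_nf

theorem reflectedCount_eq_zero (m : ℕ) {i j : ℤ} (h : i = -1 ∨ j = -1) :
    reflectedCount m (i + j) (i - j) = 0 := by
  rcases h with rfl | rfl
  · rw [reflectedCount, ← lineCount_neg m (-1 - j), ← lineCount_neg m (-1 - j + 2),
      ← lineCount_neg m (-1 - j - 2)]
    ring_nf
  · rw [reflectedCount]
    ring_nf

theorem quadrantCount_eq_reflectedCount (m : ℕ) {i j : ℤ} (hi : -1 ≤ i) (hj : -1 ≤ j) :
    quadrantCount m (i, j) = reflectedCount m (i + j) (i - j) := by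
  by_cases hb : i = -1 ∨ j = -1
  · rw [reflectedCount_eq_zero m hb, quadrantCount_eq_zero]
    simp only
    omega
  have hi' : 0 ≤ i := by omega
  have hj' : 0 ≤ j := by omega
  clear hb hi hj
  induction m generalizing i j with
  | zero =>
    rw [quadrantCount_zero]
    simp only [reflectedCount, lineCount, Prod.mk_eq_zero]
    split_ifs <;> omega
  | succ m ih =>
    have key : ∀ i j : ℤ, -1 ≤ i → -1 ≤ j →
        quadrantCount m (i, j) = reflectedCount m (i + j) (i - j) := by
      intro i j hi hj
      by_cases hb : i = -1 ∨ j = -1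
      · rw [reflectedCount_eq_zero m hb, quadrantCount_eq_zero]
        simp only
        omega
      · exact ih (by omega) (by omega)
    rw [quadrantCount_succ m ⟨hi', hj'⟩, Fin.sum_univ_four, reflectedCount_succ]
    simp only [sStep, Prod.mk_sub_mk]
    rw [key _ _ (by omega) (by omega), key _ _ (by omega) (by omega),
      key _ _ (by omega) (by omega), key _ _ (by omega) (by omega)]
    ring_nf

theorem quadrantCount_origin (n : ℕ) :
    quadrantCount (2 * n) (0, 0) =
      ((2 * n).choose n : ℤ) ^ 2 - 2 * ((2 * n).choose (n + 1) : ℤ) ^ 2 +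
        (2 * n).choose (n + 2) * (2 * n).choose n := by
  rw [quadrantCount_eq_reflectedCount _ (by norm_num) (by norm_num), reflectedCount,
    ← lineCount_neg _ (0 - 0 - 2), ← lineCount_two_mul_sub, ← lineCount_two_mul_sub,
    ← lineCount_two_mul_sub]
  push_cast
  ring_nf

theorem quadrantCount_origin_closed_form (n : ℕ) :
    (quadrantCount (2 * n) (0, 0) : ℚ) =
      1 / ((2 * n + 1) * (2 * n + 4)) * (Nat.choose (2 * n + 2) (n + 1)) ^ 2 := by
  have h₁ : ((2 * n).choose (n + 1) : ℚ) * (n + 1) = (2 * n).choose n * n := by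
    have h := Nat.choose_succ_right_eq (2 * n) n
    rw [show 2 * n - n = n by omega] at h
    exact_mod_cast h
  have h₂ : ((2 * n).choose (n + 2) : ℚ) * (n + 2) = (2 * n).choose (n + 1) * (n - 1) := by
    rcases n with _ | n
    · simp
    have h := Nat.choose_succ_right_eq (2 * (n + 1)) (n + 2)
    rw [show 2 * (n + 1) - (n + 2) = n by omega] at h
    have h' := congrArg (Nat.cast : ℕ → ℚ) h
    push_cast at h' ⊢
    linear_combination h'
  have h₃ : ((2 * n + 2).choose (n + 1) : ℚ) * (n + 1) = 2 * (2 * n + 1) * (2 * n).choose n := by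
    have h := Nat.succ_mul_centralBinom_succ n
    simp only [Nat.centralBinom, mul_add, mul_one] at h
    have h' := congrArg (Nat.cast : ℕ → ℚ) h
    push_cast at h'
    linear_combination h'
  rw [quadrantCount_origin]
  push_cast
  have e₁ : (n : ℚ) + 1 ≠ 0 := by positivity
  have e₂ : (n : ℚ) + 2 ≠ 0 := by positivity
  rw [← eq_div_iff e₁] at h₁ h₃
  rw [← eq_div_iff e₂] at h₂
  rw [h₂, h₁, h₃]
  field_simp
  ring

theorem square_quadrant_count_origin (n : ℕ) :
    (Nat.card {f : Fin (2 * n) → Fin 4 //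
        SInQuadrant f ∧ sPos f (2 * n) = (0, 0)} : ℚ) =
      1 / ((2 * n + 1) * (2 * n + 4)) * (Nat.choose (2 * n + 2) (n + 1)) ^ 2 := by
  have h := congrArg (Int.cast : ℤ → ℚ) (natCard_eq_quadrantCount (2 * n) (0, 0))
  rw [Int.cast_natCast] at h
  rw [h, quadrantCount_origin_closed_form]
end

section
/- The coefficient of t^{3k+2} in the power series 4·Σ_{k≥0} t^{3k+2}(pqr)^{k+1}·(3k)!/(k!(k+1)!(k+2)!) is asymptotic, as k → ∞, to a positive constant times (27pqr)^k·k^{-4}; consequently (since coefficients of an algebraic power series cannot have asymptotic growth C·ρ^k·k^{-4}) this power series is transcendental over Q(p,q,r)(t). -/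
open PowerSeries Filter

/-- The coefficient of `t^{3k+2}` in `4·Σ_k t^{3k+2}(pqr)^{k+1}(3k)!/(k!(k+1)!(k+2)!)`. -/
noncomputable def bCoeff (p q r : ℝ) (k : ℕ) : ℝ :=
  4 * (p * q * r) ^ (k + 1) *
    ((3 * k).factorial : ℝ) / (k.factorial * (k + 1).factorial * (k + 2).factorial)

/-- The power series `4·Σ_{k≥0} t^{3k+2}(pqr)^{k+1}(3k)!/(k!(k+1)!(k+2)!)`. -/
noncomputable def bSeries (p q r : ℝ) : PowerSeries ℝ :=
  PowerSeries.mk fun n => if n % 3 = 2 then bCoeff p q r ((n - 2) / 3) else 0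

open Stirling in
lemma bCoeff_mul_pow_four_div_pow (p q r : ℝ) (hp : 0 < p) (hq : 0 < q) (hr : 0 < r)
    {k : ℕ} (hk : k ≠ 0) :
    bCoeff p q r k * (k : ℝ) ^ 4 / (27 * p * q * r) ^ k =
      4 * (p * q * r) * (√3 / 2) * (stirlingSeq (3 * k) / stirlingSeq k ^ 3) *
        ((k : ℝ) / (k + 1)) ^ 2 * ((k : ℝ) / (k + 2)) := by
  have hk' : (0 : ℝ) < k := by positivity
  have hfac : ∀ n : ℕ, n ≠ 0 →
      (n.factorial : ℝ) = stirlingSeq n * (√(2 * n) * (n / Real.exp 1) ^ n) := by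
    intro n hn
    have : (0 : ℝ) < n := by positivity
    rw [stirlingSeq]
    field_simp
  have hS : 0 < stirlingSeq k := by
    obtain ⟨m, rfl⟩ := Nat.exists_eq_succ_of_ne_zero hk
    exact stirlingSeq'_pos m
  have h1 := hfac k hk
  have h3 := hfac (3 * k) (by omega)
  have hs3 : √(2 * ((3 * k : ℕ) : ℝ)) = √3 * √(2 * k) := by
    rw [← Real.sqrt_mul (by norm_num)]
    congr 1
    push_cast
    ring
  have hw3 : (((3 * k : ℕ) : ℝ) / Real.exp 1) ^ (3 * k) = 27 ^ k * ((k / Real.exp 1) ^ k) ^ 3 := by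
    rw [← pow_mul, mul_comm k 3, pow_mul, pow_mul _ 3 k, ← mul_pow]
    congr 1
    push_cast
    ring
  have hw : 0 < ((k : ℝ) / Real.exp 1) ^ k := by positivity
  have hss : √(2 * (k : ℝ)) ^ 2 = 2 * k := Real.sq_sqrt (by positivity)
  have hsp : 0 < √(2 * (k : ℝ)) := by positivity
  rw [hs3, hw3] at h3
  have hb : bCoeff p q r k = 4 * (p * q * r) ^ (k + 1) * ((3 * k).factorial : ℝ) /
      ((k.factorial : ℝ) ^ 3 * ((k + 1) ^ 2 * (k + 2))) := by
    rw [bCoeff, Nat.factorial_succ (k + 1), Nat.factorial_succ k]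
    push_cast
    congr 1
    ring
  have h27 : (27 * p * q * r) ^ k = 27 ^ k * (p * q * r) ^ k := by
    rw [← mul_pow]
    ring
  rw [hb, h1, h3, h27]
  generalize stirlingSeq (3 * k) = T
  generalize stirlingSeq k = S at *
  generalize ((k : ℝ) / Real.exp 1) ^ k = w at *
  have h2k : (k : ℝ) = √(2 * (k : ℝ)) ^ 2 / 2 := by linarith
  generalize √(2 * (k : ℝ)) = u at *
  have hpqr : 0 < p * q * r := by positivity
  generalize p * q * r = s at *
  have h27' : (0 : ℝ) < 27 ^ k := by positivity
  rw [pow_succ]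
  have hsk : (0 : ℝ) < s ^ k := by positivity
  generalize s ^ k = sk at *
  generalize (27 : ℝ) ^ k = z at *
  generalize (k : ℝ) = x at *
  subst h2k
  field_simp

open Stirling in
lemma tendsto_bCoeff_mul_pow_four_div_pow (p q r : ℝ) (hp : 0 < p) (hq : 0 < q) (hr : 0 < r) :
    ∃ c : ℝ, 0 < c ∧
      Tendsto (fun k : ℕ => bCoeff p q r k * (k : ℝ) ^ 4 / (27 * p * q * r) ^ k)
        atTop (nhds c) := by
  refine ⟨4 * (p * q * r) * (√3 / 2) * (√Real.pi / √Real.pi ^ 3) * 1 ^ 2 * 1, by positivity, ?_⟩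
  have hS := tendsto_stirlingSeq_sqrt_pi
  have hS3 : Tendsto (fun k : ℕ => stirlingSeq (3 * k)) atTop (nhds √Real.pi) :=
    hS.comp (tendsto_id.const_mul_atTop' (by norm_num))
  have hone : ∀ a : ℝ, Tendsto (fun k : ℕ => (k : ℝ) / (k + a)) atTop (nhds 1) :=
    fun a => tendsto_natCast_div_add_atTop a
  have hpi : √Real.pi ^ 3 ≠ 0 := by positivity
  refine Tendsto.congr' ?_ ((((hS3.div (hS.pow 3) hpi).const_mul _).mul ((hone 1).pow 2)).mul
    (hone 2))
  filter_upwards [eventually_ne_atTop 0] with k hk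
  exact (bCoeff_mul_pow_four_div_pow p q r hp hq hr hk).symm

lemma exists_derivative_aeval_eq (f : PowerSeries ℝ) (P : Polynomial (Polynomial ℝ)) :
    ∃ R : Polynomial (Polynomial ℝ), derivative ℝ (Polynomial.aeval f P) =
      Polynomial.aeval f (Polynomial.derivative P) * derivative ℝ f + Polynomial.aeval f R := by
  induction P using Polynomial.induction_on' with
  | add P Q hP hQ =>
    obtain ⟨R, hR⟩ := hP
    obtain ⟨S, hS⟩ := hQ
    exact ⟨R + S, by simp only [map_add, hR, hS]; ring⟩
  | monomial n a =>
    refine ⟨Polynomial.monomial n (Polynomial.derivative a), ?_⟩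
    simp only [Polynomial.aeval_monomial, Polynomial.derivative_monomial, Derivation.leibniz,
      Derivation.leibniz_pow, smul_eq_mul, map_mul, map_natCast, algebraMap_apply',
      Algebra.algebraMap_self, PowerSeries.map_id, id_eq, derivative_coe,
      nsmul_eq_mul]
    ring

lemma isAlgebraic_derivative {f : PowerSeries ℝ} (hf : IsAlgebraic (Polynomial ℝ) f) :
    IsAlgebraic (Polynomial ℝ) (derivative ℝ f) := by
  classical
  have hex : ∃ n, ∃ P : Polynomial (Polynomial ℝ),
      P ≠ 0 ∧ Polynomial.aeval f P = 0 ∧ P.natDegree = n :=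
    let ⟨P, hP, h0⟩ := hf
    ⟨_, P, hP, h0, rfl⟩
  obtain ⟨P, hP, h0, hdeg⟩ := Nat.find_spec hex
  have hinj : Function.Injective (algebraMap (Polynomial ℝ) (PowerSeries ℝ)) := by
    intro a b h
    simpa [algebraMap_apply'] using h
  have hpos : 0 < P.natDegree := by
    rw [Nat.pos_iff_ne_zero]
    intro h
    obtain ⟨a, rfl⟩ := Polynomial.natDegree_eq_zero.mp h
    rw [Polynomial.aeval_C, map_eq_zero_iff _ hinj] at h0
    exact hP (by rw [h0, map_zero])
  have hder : Polynomial.aeval f (Polynomial.derivative P) ≠ 0 := by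
    intro h
    refine Nat.find_min hex (m := (Polynomial.derivative P).natDegree) ?_ ⟨_, ?_, h, rfl⟩
    · rw [← hdeg]
      exact Polynomial.natDegree_derivative_lt hpos.ne'
    · intro h'
      exact hpos.ne' (Polynomial.derivative_eq_zero.mp h')
  obtain ⟨R, hR⟩ := exists_derivative_aeval_eq f P
  rw [h0, map_zero] at hR
  have halg : ∀ Q : Polynomial (Polynomial ℝ), IsAlgebraic (Polynomial ℝ) (Polynomial.aeval f Q) :=
    fun Q => Algebra.isAlgebraic_adjoin_singleton_iff.mpr hf _
      (Polynomial.aeval_mem_adjoin_singleton _ _)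
  refine (halg (Polynomial.derivative P)).of_mul (mem_nonZeroDivisors_of_ne_zero hder) ?_
  rw [eq_neg_of_add_eq_zero_left hR.symm]
  exact (halg R).neg

lemma isAlgebraic_X_mul_derivative {f : PowerSeries ℝ} (hf : IsAlgebraic (Polynomial ℝ) f) :
    IsAlgebraic (Polynomial ℝ) (X * derivative ℝ f) := by
  have hX : IsAlgebraic (Polynomial ℝ) (X : PowerSeries ℝ) := by
    simpa [algebraMap_apply'] using
      isAlgebraic_algebraMap (R := Polynomial ℝ) (A := PowerSeries ℝ) Polynomial.X
  exact hX.mul (isAlgebraic_derivative hf)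

/-- `f` converges absolutely at `t`, with sum `v`. -/
def AbsHasSumAt (t : ℝ) (f : PowerSeries ℝ) (v : ℝ) : Prop :=
  Summable (fun n => ‖coeff n f * t ^ n‖) ∧ HasSum (fun n => coeff n f * t ^ n) v

namespace AbsHasSumAt

variable {t v w : ℝ} {f g : PowerSeries ℝ}

lemma add (hf : AbsHasSumAt t f v) (hg : AbsHasSumAt t g w) : AbsHasSumAt t (f + g) (v + w) := by
  have h : (fun n => coeff n (f + g) * t ^ n) =
      fun n => coeff n f * t ^ n + coeff n g * t ^ n := by
    ext n
    rw [map_add, add_mul]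
  have hs := hf.2.add hg.2
  rw [← h] at hs
  exact ⟨hs.summable.norm, hs⟩

lemma mul (hf : AbsHasSumAt t f v) (hg : AbsHasSumAt t g w) : AbsHasSumAt t (f * g) (v * w) := by
  have h : ∀ n, coeff n (f * g) * t ^ n = ∑ kl ∈ Finset.HasAntidiagonal.antidiagonal n,
      coeff kl.1 f * t ^ kl.1 * (coeff kl.2 g * t ^ kl.2) := by
    intro n
    rw [coeff_mul, Finset.sum_mul]
    refine Finset.sum_congr rfl fun kl hkl => ?_
    rw [← Finset.HasAntidiagonal.mem_antidiagonal.mp hkl, pow_add]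
    ring
  have hs := summable_norm_sum_mul_antidiagonal_of_summable_norm hf.1 hg.1
  simp only [AbsHasSumAt, h]
  refine ⟨hs, ?_⟩
  rw [← hf.2.tsum_eq, ← hg.2.tsum_eq,
    tsum_mul_tsum_eq_tsum_sum_antidiagonal_of_summable_norm hf.1 hg.1]
  exact hs.of_norm.hasSum

lemma coe (t : ℝ) (a : Polynomial ℝ) : AbsHasSumAt t (a : PowerSeries ℝ) (a.eval t) := by
  have hs : HasSum (fun n => coeff n (a : PowerSeries ℝ) * t ^ n) (a.eval t) := by
    rw [Polynomial.eval_eq_sum, Polynomial.sum_def]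
    simp only [Polynomial.coeff_coe]
    refine hasSum_sum_of_ne_finset_zero fun n hn => ?_
    rw [Polynomial.notMem_support_iff.mp hn, zero_mul]
  exact ⟨hs.summable.norm, hs⟩

lemma pow (hf : AbsHasSumAt t f v) (n : ℕ) : AbsHasSumAt t (f ^ n) (v ^ n) := by
  induction n with
  | zero => simpa using coe t 1
  | succ n ih => simpa only [pow_succ] using ih.mul hf

lemma aeval (hf : AbsHasSumAt t f v) (P : Polynomial (Polynomial ℝ)) :
    AbsHasSumAt t (Polynomial.aeval f P) ((P.map (Polynomial.evalRingHom t)).eval v) := by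
  induction P using Polynomial.induction_on' with
  | add P Q hP hQ => simpa using hP.add hQ
  | monomial n a => simpa [algebraMap_apply'] using (coe t a).mul (hf.pow n)

lemma eval_map_eq_zero (hf : AbsHasSumAt t f v) {P : Polynomial (Polynomial ℝ)}
    (hP : Polynomial.aeval f P = 0) : (P.map (Polynomial.evalRingHom t)).eval v = 0 := by
  have h := (hf.aeval P).2
  rw [hP] at h
  simpa using h.unique (by simp)

end AbsHasSumAt

lemma tendsto_eval_map_sub {ι : Type*} {l : Filter ι} {t v : ι → ℝ} {ρ : ℝ}
    (ht : Tendsto t l (nhds ρ))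
    (hsmall : ∀ n : ℕ, Tendsto (fun i => (t i - ρ) * v i ^ n) l (nhds 0))
    (Q : Polynomial (Polynomial ℝ)) :
    Tendsto (fun i => (Q.map (Polynomial.evalRingHom (t i))).eval (v i) -
      (Q.map (Polynomial.evalRingHom ρ)).eval (v i)) l (nhds 0) := by
  induction Q using Polynomial.induction_on' with
  | add P Q hP hQ =>
    refine (by simpa using hP.add hQ : Tendsto _ l (nhds (0 : ℝ))).congr fun i => ?_
    simp only [Polynomial.map_add, Polynomial.eval_add]
    ring
  | monomial n a =>
    obtain ⟨b, hb⟩ := Polynomial.X_sub_C_dvd_sub_C_eval (a := ρ) (p := a)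
    have hcont : Tendsto (fun i => b.eval (t i)) l (nhds (b.eval ρ)) :=
      (b.continuous.tendsto ρ).comp ht
    refine (by simpa using hcont.mul (hsmall n) : Tendsto _ l (nhds (0 : ℝ))).congr fun i => ?_
    have h := congrArg (Polynomial.eval (t i)) hb
    simp only [Polynomial.eval_sub, Polynomial.eval_C, Polynomial.eval_mul, Polynomial.eval_X] at h
    simp only [Polynomial.map_monomial, Polynomial.eval_monomial, Polynomial.coe_evalRingHom]
    rw [← sub_mul, h]
    ring

/-- A function that tends to infinity at a point `ρ` more slowly than every negative power of the
distance to `ρ` satisfies no nontrivial polynomial equation near `ρ`. -/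
lemma eq_zero_of_eventually_eval_map_eq_zero {ι : Type*} {l : Filter ι} [l.NeBot] {t v : ι → ℝ}
    {ρ : ℝ} (ht : Tendsto t l (nhds ρ)) (hv : Tendsto v l atTop)
    (hsmall : ∀ n : ℕ, Tendsto (fun i => (t i - ρ) * v i ^ n) l (nhds 0))
    (hne : ∀ᶠ i in l, t i ≠ ρ) {P : Polynomial (Polynomial ℝ)}
    (hP : ∀ᶠ i in l, (P.map (Polynomial.evalRingHom (t i))).eval (v i) = 0) : P = 0 := by
  by_contra hP0
  have hirr : Irreducible (Polynomial.C (Polynomial.X - Polynomial.C ρ)) :=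
    (Polynomial.prime_C_iff.mpr (Polynomial.prime_X_sub_C ρ)).irreducible
  obtain ⟨m, Q, hQ, rfl⟩ := WfDvdMonoid.max_power_factor hP0 hirr
  have hQ0 : ∀ᶠ i in l, (Q.map (Polynomial.evalRingHom (t i))).eval (v i) = 0 := by
    filter_upwards [hP, hne] with i hi hi'
    simpa [sub_eq_zero, hi'] using hi
  have hlim : Tendsto (fun i => (Q.map (Polynomial.evalRingHom ρ)).eval (v i)) l (nhds 0) := by
    have h := (tendsto_eval_map_sub ht hsmall Q).neg
    rw [neg_zero] at h
    refine h.congr' ?_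
    filter_upwards [hQ0] with i hi
    rw [hi]
    ring
  have hmap : Q.map (Polynomial.evalRingHom ρ) ≠ 0 := by
    intro h
    refine hQ ((Polynomial.C_dvd_iff_dvd_coeff _ _).mpr fun n => ?_)
    rw [Polynomial.dvd_iff_isRoot]
    simpa using congrArg (Polynomial.coeff · n) h
  by_cases hd : 0 < (Q.map (Polynomial.evalRingHom ρ)).degree
  · exact not_tendsto_atTop_of_tendsto_nhds hlim.abs
      ((Polynomial.abs_tendsto_atTop _ hd).comp hv)
  · rw [Polynomial.eq_C_of_degree_le_zero (not_lt.mp hd)] at hlim hmap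
    simp only [Polynomial.eval_C] at hlim
    rw [tendsto_nhds_unique tendsto_const_nhds hlim, map_zero] at hmap
    exact hmap rfl

lemma exists_absHasSumAt_of_coeff_bounds {f : PowerSeries ℝ} {s A B : ℝ} (hs : 0 < s)
    (hA : 0 < A) (hf : ∀ n, n % 3 ≠ 2 → coeff n f = 0)
    (hlow : ∀ k : ℕ, A / (k + 1) ≤ coeff (3 * k + 2) f / s ^ k)
    (hup : ∀ k : ℕ, coeff (3 * k + 2) f / s ^ k ≤ B / (k + 1))
    {t : ℝ} (ht : 0 < t) (hst : s * t ^ 3 < 1) :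
    ∃ v, AbsHasSumAt t f v ∧
      A * (t ^ 2 / (s * t ^ 3)) * -Real.log (1 - s * t ^ 3) ≤ v ∧
      v ≤ B * (t ^ 2 / (s * t ^ 3)) * -Real.log (1 - s * t ^ 3) := by
  have hx : 0 < s * t ^ 3 := by positivity
  have hterm : ∀ k : ℕ, coeff (3 * k + 2) f * t ^ (3 * k + 2) =
      t ^ 2 * (coeff (3 * k + 2) f / s ^ k) * (s * t ^ 3) ^ k := by
    intro k
    rw [mul_pow, pow_add, pow_mul]
    field_simp
  have hlog : ∀ C : ℝ, HasSum (fun k : ℕ => t ^ 2 * (C / (k + 1)) * (s * t ^ 3) ^ k)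
      (C * (t ^ 2 / (s * t ^ 3)) * -Real.log (1 - s * t ^ 3)) := by
    intro C
    have h := (Real.hasSum_pow_div_log_of_abs_lt_one
      (by rwa [abs_of_pos hx] : |s * t ^ 3| < 1)).mul_left (C * (t ^ 2 / (s * t ^ 3)))
    refine h.congr_fun fun k => ?_
    field_simp
    ring
  have hlow' : ∀ k : ℕ, t ^ 2 * (A / (k + 1)) * (s * t ^ 3) ^ k ≤
      coeff (3 * k + 2) f * t ^ (3 * k + 2) := by
    intro k
    rw [hterm]
    exact mul_le_mul_of_nonneg_right (mul_le_mul_of_nonneg_left (hlow k) (sq_nonneg t))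
      (pow_nonneg hx.le k)
  have hup' : ∀ k : ℕ, coeff (3 * k + 2) f * t ^ (3 * k + 2) ≤
      t ^ 2 * (B / (k + 1)) * (s * t ^ 3) ^ k := by
    intro k
    rw [hterm]
    exact mul_le_mul_of_nonneg_right (mul_le_mul_of_nonneg_left (hup k) (sq_nonneg t))
      (pow_nonneg hx.le k)
  have hsum : Summable fun k : ℕ => coeff (3 * k + 2) f * t ^ (3 * k + 2) :=
    Summable.of_nonneg_of_le (fun k => le_trans (by positivity) (hlow' k)) hup' (hlog B).summable
  have hinj : Function.Injective fun k : ℕ => 3 * k + 2 := fun a b h => by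
    simp only at h
    omega
  have hfull : HasSum (fun n => coeff n f * t ^ n)
      (∑' k : ℕ, coeff (3 * k + 2) f * t ^ (3 * k + 2)) := by
    refine (hinj.hasSum_iff fun n hn => ?_).mp hsum.hasSum
    rw [hf n fun h => hn ⟨n / 3, by simp only; omega⟩, zero_mul]
  exact ⟨_, ⟨hfull.summable.norm, hfull⟩, hasSum_le hlow' (hlog A) hsum.hasSum,
    hasSum_le hup' hsum.hasSum (hlog B)⟩

/-- A power series supported on exponents `3k + 2`, whose coefficients are comparable to
`s ^ k / (k + 1)`, has a logarithmic singularity and hence is transcendental. -/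
lemma transcendental_of_coeff_bounds {f : PowerSeries ℝ} {s A B : ℝ} (hs : 0 < s)
    (hA : 0 < A) (hf : ∀ n, n % 3 ≠ 2 → coeff n f = 0)
    (hlow : ∀ k : ℕ, A / (k + 1) ≤ coeff (3 * k + 2) f / s ^ k)
    (hup : ∀ k : ℕ, coeff (3 * k + 2) f / s ^ k ≤ B / (k + 1)) :
    Transcendental (Polynomial ℝ) f := by
  rintro ⟨P, hP, hPf⟩
  obtain ⟨ρ, hρ, hsρ⟩ : ∃ ρ : ℝ, 0 < ρ ∧ s * ρ ^ 3 = 1 := by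
    refine ⟨(s⁻¹) ^ ((3 : ℕ) : ℝ)⁻¹, by positivity, ?_⟩
    rw [Real.rpow_inv_natCast_pow (by positivity) (by norm_num), mul_inv_cancel₀ hs.ne']
  have hB : 0 < B := by
    have h := (hlow 0).trans (hup 0)
    simp only [Nat.cast_zero, zero_add, div_one] at h
    linarith
  have hmem : ∀ᶠ t in nhdsWithin ρ (Set.Iio ρ), 0 < t ∧ t < ρ :=
    Ioo_mem_nhdsLT hρ
  have hlt : ∀ t : ℝ, 0 < t → t < ρ → s * t ^ 3 < 1 := by
    intro t h0 h1
    rw [← hsρ]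
    gcongr
  choose! v hv hv_low hv_up using fun (t : ℝ) (h : 0 < t ∧ t < ρ) =>
    exists_absHasSumAt_of_coeff_bounds hs hA hf hlow hup h.1 (hlt t h.1 h.2)
  have ht : Tendsto (fun t : ℝ => t) (nhdsWithin ρ (Set.Iio ρ)) (nhds ρ) := nhdsWithin_le_nhds
  have hx : Tendsto (fun t : ℝ => s * t ^ 3) (nhdsWithin ρ (Set.Iio ρ)) (nhds 1) := by
    simpa only [hsρ] using (ht.pow 3).const_mul s
  have hu : Tendsto (fun t : ℝ => (1 - s * t ^ 3)⁻¹) (nhdsWithin ρ (Set.Iio ρ)) atTop := by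
    refine tendsto_inv_nhdsGT_zero.comp (tendsto_nhdsWithin_iff.mpr ⟨?_, ?_⟩)
    · simpa using hx.const_sub 1
    · filter_upwards [hmem] with t h
      exact sub_pos.mpr (hlt t h.1 h.2)
  have hlogu : ∀ t : ℝ, Real.log (1 - s * t ^ 3)⁻¹ = -Real.log (1 - s * t ^ 3) :=
    fun t => Real.log_inv _
  have hL : Tendsto (fun t : ℝ => -Real.log (1 - s * t ^ 3)) (nhdsWithin ρ (Set.Iio ρ)) atTop := by
    simpa only [Function.comp_def, hlogu] using Real.tendsto_log_atTop.comp hu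
  have hfactor : ∀ C : ℝ, Tendsto (fun t : ℝ => C * (t ^ 2 / (s * t ^ 3)))
      (nhdsWithin ρ (Set.Iio ρ)) (nhds (C * ρ ^ 2)) := by
    intro C
    simpa using ((ht.pow 2).div hx one_ne_zero).const_mul C
  refine hP (eq_zero_of_eventually_eval_map_eq_zero (v := v) ht ?_ ?_ ?_ ?_)
  · refine tendsto_atTop_mono' _ ?_ ((hfactor A).pos_mul_atTop (by positivity) hL)
    filter_upwards [hmem] with t h
    exact hv_low t h
  · intro n
    have hdecay : Tendsto (fun t : ℝ => (-Real.log (1 - s * t ^ 3)) ^ n * (1 - s * t ^ 3))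
        (nhdsWithin ρ (Set.Iio ρ)) (nhds 0) := by
      simpa [Function.comp_def, hlogu] using
        ((Real.isLittleO_pow_log_id_atTop (n := n)).tendsto_div_nhds_zero).comp hu
    have hbound : Tendsto (fun t : ℝ => ρ * ((B * (t ^ 2 / (s * t ^ 3))) ^ n *
        ((-Real.log (1 - s * t ^ 3)) ^ n * (1 - s * t ^ 3))))
        (nhdsWithin ρ (Set.Iio ρ)) (nhds 0) := by
      simpa using (((hfactor B).pow n).mul hdecay).const_mul ρ
    refine squeeze_zero_norm' ?_ hbound
    filter_upwards [hmem] with t h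
    have hx1 := hlt t h.1 h.2
    have hLpos : 0 ≤ -Real.log (1 - s * t ^ 3) := by
      have h0 : 0 < s * t ^ 3 := mul_pos hs (pow_pos h.1 3)
      exact neg_nonneg.mpr (Real.log_nonpos (by linarith) (by linarith))
    have hvpos : 0 ≤ v t := by
      refine le_trans (mul_nonneg ?_ hLpos) (hv_low t h)
      have := h.1
      positivity
    have hdist : ρ - t ≤ ρ * (1 - s * t ^ 3) := by
      have h1 : s * t ^ 2 * ρ ≤ s * ρ ^ 2 * ρ := by
        have := h.1.le
        have := h.2.le
        gcongr
      nlinarith [mul_le_mul_of_nonneg_left h1 h.1.le]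
    rw [norm_mul, norm_pow, Real.norm_eq_abs, Real.norm_eq_abs, abs_of_nonneg hvpos, abs_sub_comm,
      abs_of_pos (sub_pos.mpr h.2)]
    calc (ρ - t) * v t ^ n ≤ ρ * (1 - s * t ^ 3) *
          (B * (t ^ 2 / (s * t ^ 3)) * -Real.log (1 - s * t ^ 3)) ^ n := by
          have h1 : 0 ≤ 1 - s * t ^ 3 := by linarith
          gcongr
          exact hv_up t h
      _ = _ := by
          rw [mul_pow]
          ring
  · filter_upwards [hmem] with t h
    exact h.2.ne
  · filter_upwards [hmem] with t h
    exact (hv t h).eval_map_eq_zero hPf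

lemma coeff_X_mul_derivative (f : PowerSeries ℝ) (n : ℕ) :
    coeff n (X * derivative ℝ f) = n * coeff n f := by
  cases n with
  | zero => simp
  | succ n =>
    rw [coeff_succ_X_mul, coeff_derivative]
    push_cast
    ring

lemma exists_bounds_of_tendsto_pos {u : ℕ → ℝ} {L : ℝ} (hu : ∀ k, 0 < u k) (hL : 0 < L)
    (h : Tendsto u atTop (nhds L)) : ∃ A B : ℝ, 0 < A ∧ ∀ k, A ≤ u k ∧ u k ≤ B := by
  obtain ⟨B, hB⟩ := h.bddAbove_range
  obtain ⟨M, hM⟩ := (h.inv₀ hL.ne').bddAbove_range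
  have hM' : ∀ k, (u k)⁻¹ ≤ M := fun k => hM ⟨k, rfl⟩
  have hMpos : 0 < M := (inv_pos.mpr (hu 0)).trans_le (hM' 0)
  exact ⟨M⁻¹, B, inv_pos.mpr hMpos, fun k =>
    ⟨inv_le_of_inv_le₀ (hu k) (hM' k), hB ⟨k, rfl⟩⟩⟩

lemma exists_bounds_cube_mul_bCoeff (p q r : ℝ) (hp : 0 < p) (hq : 0 < q) (hr : 0 < r) :
    ∃ A B : ℝ, 0 < A ∧ ∀ k : ℕ,
      A / (k + 1) ≤ (3 * k + 2 : ℝ) ^ 3 * bCoeff p q r k / (27 * p * q * r) ^ k ∧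
      (3 * k + 2 : ℝ) ^ 3 * bCoeff p q r k / (27 * p * q * r) ^ k ≤ B / (k + 1) := by
  obtain ⟨c, hc, hlim⟩ := tendsto_bCoeff_mul_pow_four_div_pow p q r hp hq hr
  have hquot : ∀ a : ℝ, Tendsto (fun k : ℕ => ((k : ℝ) / (k + a))⁻¹) atTop (nhds 1) := by
    intro a
    simpa using (tendsto_natCast_div_add_atTop a).inv₀ one_ne_zero
  have hu : Tendsto (fun k : ℕ =>
      (3 * k + 2 : ℝ) ^ 3 * bCoeff p q r k / (27 * p * q * r) ^ k * (k + 1)) atTop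
      (nhds (c * (3 * 1) ^ 3 * 1)) := by
    refine ((hlim.mul (((hquot (2 / 3)).const_mul 3).pow 3)).mul (hquot 1)).congr' ?_
    filter_upwards [eventually_gt_atTop 0] with k hk
    have hk' : (0 : ℝ) < k := by positivity
    field_simp
  obtain ⟨A, B, hA, hAB⟩ := exists_bounds_of_tendsto_pos (fun k => by unfold bCoeff; positivity)
    (by positivity) hu
  refine ⟨A, B, hA, fun k => ?_⟩
  have hk : (0 : ℝ) < k + 1 := by positivity
  rw [div_le_iff₀ hk, le_div_iff₀ hk]
  exact hAB k

lemma transcendental_bSeries (p q r : ℝ) (hp : 0 < p) (hq : 0 < q) (hr : 0 < r) :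
    Transcendental (Polynomial ℝ) (bSeries p q r) := by
  intro halg
  obtain ⟨A, B, hA, hAB⟩ := exists_bounds_cube_mul_bCoeff p q r hp hq hr
  have hcoeff : ∀ k : ℕ, coeff (3 * k + 2) (X * derivative ℝ (X * derivative ℝ
      (X * derivative ℝ (bSeries p q r)))) = (3 * k + 2 : ℝ) ^ 3 * bCoeff p q r k := by
    intro k
    have h1 : (3 * k + 2) % 3 = 2 := by omega
    simp only [coeff_X_mul_derivative, bSeries, coeff_mk, h1, if_true, Nat.add_sub_cancel,
      Nat.mul_div_cancel_left k three_pos]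
    push_cast
    ring
  refine transcendental_of_coeff_bounds (s := 27 * p * q * r) (B := B) (by positivity) hA (fun n hn => ?_)
    (fun k => ?_) (fun k => ?_) (isAlgebraic_X_mul_derivative (isAlgebraic_X_mul_derivative
      (isAlgebraic_X_mul_derivative halg)))
  · simp only [coeff_X_mul_derivative, bSeries, coeff_mk, hn, if_false, mul_zero]
  · rw [hcoeff]
    exact (hAB k).1
  · rw [hcoeff]
    exact (hAB k).2

/-- The coefficients of the series are asymptotic to a positive constant times
`(27pqr)^k·k⁻⁴`; consequently the series is transcendental (over the rational
functions in `t`). -/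
theorem bSeries_asymptotics_and_transcendence (p q r : ℝ)
    (hp : 0 < p) (hq : 0 < q) (hr : 0 < r) :
    (∃ c : ℝ, 0 < c ∧
      Tendsto (fun k : ℕ => bCoeff p q r k * (k : ℝ) ^ 4 / (27 * p * q * r) ^ k)
        atTop (nhds c)) ∧
    (∀ P : Polynomial (Polynomial ℝ),
      Polynomial.eval₂ (Polynomial.coeToPowerSeries.ringHom) (bSeries p q r) P = 0 →
        P = 0) := by
  refine ⟨tendsto_bCoeff_mul_pow_four_div_pow p q r hp hq hr, fun P hP => ?_⟩
  have hmap : algebraMap (Polynomial ℝ) (PowerSeries ℝ) =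
      Polynomial.coeToPowerSeries.ringHom :=
    RingHom.ext fun a => by simp [algebraMap_apply']
  rw [← hmap] at hP
  exact transcendental_iff.mp (transcendental_bSeries p q r hp hq hr) P hP
end
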